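/- Let μ = μ₁⊗⋯⊗μ_k be a product probability measure and let f : V → ℝ have degree at most d. Then (1/2)·‖f‖₄⁴ ≤ 9^d·‖f‖₂⁴ + Σ_{T⊆[k], T≠∅} (4d)^{|T|}·‖L_T[f]‖₄⁴. -/

import Mathlib

open Finset

namespace GLL

variable {k : ℕ} {V : Fin k → Type} [∀ i, Fintype (V i)] [∀ i, DecidableEq (V i)]

/-- Expectation of `f` with respect to the (finitely supported) measure `μ`. -/
def expect (μ f : (∀ i, V i) → ℝ) : ℝ := ∑ x, μ x * f x

/-- `μ` is a probability measure. -/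
def IsProb (μ : (∀ i, V i) → ℝ) : Prop := (∀ x, 0 ≤ μ x) ∧ ∑ x, μ x = 1

/-- The marginal `μ_S` evaluated at (the `S`-coordinates of) `x`. -/
def marg (μ : (∀ i, V i) → ℝ) (S : Finset (Fin k)) (x : ∀ i, V i) : ℝ :=
  ∑ z, if ∀ i ∈ S, z i = x i then μ z else 0

/-- The link (conditional) measure `μ_x` for `x ∈ V_S`, viewed as a measure on
full points agreeing with `x` on `S`. -/
noncomputable def cond (μ : (∀ i, V i) → ℝ) (S : Finset (Fin k)) (x z : ∀ i, V i) : ℝ :=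
  if ∀ i ∈ S, z i = x i then μ z / marg μ S x else 0

/-- The averaging operator `A_S`: `A_S f (x) = E_{y ∼ μ_{x_S}} [f(x_S, y)]`.
Applied to an `S'`-junta `f`, this is also the operator `A_{S',S}`. -/
noncomputable def Aop (μ : (∀ i, V i) → ℝ) (S : Finset (Fin k)) (f : (∀ i, V i) → ℝ)
    (x : ∀ i, V i) : ℝ :=
  ∑ z, cond μ S x z * f z

/-- The Efron–Stein component `f^{=S} = ∑_{T ⊆ S} (-1)^{|S∖T|} A_T f`. -/
noncomputable def ES (μ : (∀ i, V i) → ℝ) (S : Finset (Fin k)) (f : (∀ i, V i) → ℝ)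
    (x : ∀ i, V i) : ℝ :=
  ∑ T ∈ S.powerset, (-1 : ℝ) ^ (S.card - T.card) * Aop μ T f x

/-- The low-degree part `f^{≤ d} = ∑_{|S| ≤ d} f^{=S}`. -/
noncomputable def lowPart (μ : (∀ i, V i) → ℝ) (d : ℕ) (f : (∀ i, V i) → ℝ)
    (x : ∀ i, V i) : ℝ :=
  ∑ S ∈ univ.powerset.filter (fun S : Finset (Fin k) => S.card ≤ d), ES μ S f x

/-- The Laplacian `L_S[f] = ∑_{T ⊇ S} f^{=T}`. -/
noncomputable def Lap (μ : (∀ i, V i) → ℝ) (S : Finset (Fin k)) (f : (∀ i, V i) → ℝ)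
    (x : ∀ i, V i) : ℝ :=
  ∑ T ∈ univ.powerset.filter (fun T : Finset (Fin k) => S ⊆ T), ES μ T f x

/-- The truncated Laplacian `L_S^{≤d}[f] = ∑_{T ⊇ S, |T| ≤ d} f^{=T}`. -/
noncomputable def LapLe (μ : (∀ i, V i) → ℝ) (d : ℕ) (S : Finset (Fin k))
    (f : (∀ i, V i) → ℝ) (x : ∀ i, V i) : ℝ :=
  ∑ T ∈ univ.powerset.filter (fun T : Finset (Fin k) => S ⊆ T ∧ T.card ≤ d), ES μ T f x

/-- The influence `I_{S,x}[f] = ‖L_S[f](x,·)‖²_{L²(μ_x)}`. -/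
noncomputable def Inf (μ : (∀ i, V i) → ℝ) (S : Finset (Fin k)) (f : (∀ i, V i) → ℝ)
    (x : ∀ i, V i) : ℝ :=
  ∑ z, cond μ S x z * (Lap μ S f z) ^ 2

/-- The truncated influence `I^{≤d}_{S,x}[f] = ‖L_S^{≤d}[f](x,·)‖²_{L²(μ_x)}`. -/
noncomputable def InfLe (μ : (∀ i, V i) → ℝ) (d : ℕ) (S : Finset (Fin k))
    (f : (∀ i, V i) → ℝ) (x : ∀ i, V i) : ℝ :=
  ∑ z, cond μ S x z * (LapLe μ d S f z) ^ 2

/-- `‖f‖₂²` with respect to `μ`. -/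
def normSq (μ f : (∀ i, V i) → ℝ) : ℝ := ∑ x, μ x * (f x) ^ 2

/-- `‖f‖₄⁴` with respect to `μ`. -/
def norm4p4 (μ f : (∀ i, V i) → ℝ) : ℝ := ∑ x, μ x * (f x) ^ 4

/-- `‖f‖₂` with respect to `μ`. -/
noncomputable def l2norm (μ f : (∀ i, V i) → ℝ) : ℝ := Real.sqrt (normSq μ f)

/-- `‖f‖_∞`: the maximum of `|f|` over the support of `μ`. -/
noncomputable def supNorm (μ f : (∀ i, V i) → ℝ) : ℝ :=
  sSup ((fun x => |f x|) '' {x | 0 < μ x})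

/-- Inner product `⟨f, g⟩ = E_{x∼μ}[f(x) g(x)]`. -/
def inner' (μ f g : (∀ i, V i) → ℝ) : ℝ := ∑ x, μ x * (f x * g x)

/-- The pair `{i,j}`-skeleton of `μ` is `ε`-pseudorandom. -/
def PairPseudo (μ : (∀ i, V i) → ℝ) (ε : ℝ) (i j : Fin k) : Prop :=
  ∀ (f₁ : V i → ℝ) (f₂ : V j → ℝ),
    |expect μ (fun x => f₁ (x i) * f₂ (x j)) -
        expect μ (fun x => f₁ (x i)) * expect μ (fun x => f₂ (x j))| ≤
      ε * Real.sqrt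
        ((expect μ (fun x => f₁ (x i) ^ 2) - expect μ (fun x => f₁ (x i)) ^ 2) *
          (expect μ (fun x => f₂ (x j) ^ 2) - expect μ (fun x => f₂ (x j)) ^ 2))

/-- `μ` is an `ε`-product measure: every link of every restriction of size `≤ k - 2`
has `ε`-pseudorandom skeletons. -/
def EpsProduct (μ : (∀ i, V i) → ℝ) (ε : ℝ) : Prop :=
  ∀ S : Finset (Fin k), S.card ≤ k - 2 → ∀ x, 0 < marg μ S x →
    ∀ i j : Fin k, i ∉ S → j ∉ S → i ≠ j → PairPseudo (cond μ S x) ε i j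

/-- `‖f(x,·)‖_{L²(μ_x)}` for `x ∈ V_S`. -/
noncomputable def restrictNorm (μ : (∀ i, V i) → ℝ) (S : Finset (Fin k)) (x : ∀ i, V i)
    (f : (∀ i, V i) → ℝ) : ℝ :=
  Real.sqrt (∑ z, cond μ S x z * (f z) ^ 2)

/-- `f` is `(d, δ)`-global: all restrictions of at most `d` coordinates have
`2`-norm at most `δ`. -/
def IsGlobal (μ : (∀ i, V i) → ℝ) (d : ℕ) (δ : ℝ) (f : (∀ i, V i) → ℝ) : Prop :=
  ∀ S : Finset (Fin k), S.card ≤ d → ∀ x, 0 < marg μ S x → restrictNorm μ S x f ≤ δ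

/-- `f` is an `S`-junta: it depends only on the coordinates in `S`. -/
def Junta (S : Finset (Fin k)) (f : (∀ i, V i) → ℝ) : Prop :=
  ∀ x y, (∀ i ∈ S, x i = y i) → f x = f y

/-- The noise operator `T_ρ f = ∑_{S ⊆ [k]} ρ^{|S|} (1-ρ)^{k-|S|} A_S f`. -/
noncomputable def noiseOp (μ : (∀ i, V i) → ℝ) (ρ : ℝ) (f : (∀ i, V i) → ℝ)
    (x : ∀ i, V i) : ℝ :=
  ∑ S ∈ (univ : Finset (Fin k)).powerset, ρ ^ S.card * (1 - ρ) ^ (k - S.card) * Aop μ S f x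

/-- The up-down walk operator `T = (1/k) ∑_{i=1}^k A_{[k]∖{i}}`. -/
noncomputable def upDown (μ : (∀ i, V i) → ℝ) (f : (∀ i, V i) → ℝ) (x : ∀ i, V i) : ℝ :=
  (1 / (k : ℝ)) * ∑ i : Fin k, Aop μ (univ.erase i) f x

/-- The product measure `μ₁ ⊗ ⋯ ⊗ μ_k`. -/
def prodMeasure (μi : ∀ i, V i → ℝ) : (∀ i, V i) → ℝ := fun x => ∏ i, μi i (x i)

/-- `f` has degree at most `d`: `f^{=S} = 0` whenever `|S| > d`. -/
def DegLe (μ : (∀ i, V i) → ℝ) (d : ℕ) (f : (∀ i, V i) → ℝ) : Prop :=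
  ∀ S : Finset (Fin k), d < S.card → ∀ x, ES μ S f x = 0

/-- `{F S}_{S ⊆ [k]}` is an `(α, ε')`-approximate Efron–Stein decomposition of `f`. -/
noncomputable def ApproxES (μ : (∀ i, V i) → ℝ) (α ε' : ℝ) (f : (∀ i, V i) → ℝ)
    (F : Finset (Fin k) → (∀ i, V i) → ℝ) : Prop :=
  l2norm μ f ≤ α ∧
    l2norm μ (fun x => f x - ∑ S ∈ (univ : Finset (Fin k)).powerset, F S x) ≤ ε' ∧
    ∀ S : Finset (Fin k), ∃ h : (∀ i, V i) → ℝ,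
      l2norm μ h ≤ α ∧ l2norm μ (fun x => ES μ S h x - F S x) ≤ ε'

section Averaging

omit [∀ i, DecidableEq (V i)]

variable (μi : ∀ i, V i → ℝ)

/-- Averaging over the coordinates outside `S` against the product weights `μi`; unlike `Aop` it
involves no conditioning, so that it is well behaved off the support of the measure. -/
def avg (S : Finset (Fin k)) : ((∀ i, V i) → ℝ) →ₗ[ℝ] ((∀ i, V i) → ℝ) where
  toFun f x := ∑ z, prodMeasure μi z * f (S.piecewise x z)
  map_add' f g := by
    funext x
    simp [mul_add, sum_add_distrib]
  map_smul' c f := by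
    funext x
    simp [mul_sum, mul_left_comm]

theorem avg_apply (S : Finset (Fin k)) (f : (∀ i, V i) → ℝ) (x : ∀ i, V i) :
    avg μi S f x = ∑ z, prodMeasure μi z * f (S.piecewise x z) := rfl

/-- The Efron–Stein projection built from `avg`. -/
noncomputable def comp (S : Finset (Fin k)) : ((∀ i, V i) → ℝ) →ₗ[ℝ] ((∀ i, V i) → ℝ) :=
  (-1 : ℝ) ^ #S • ∑ T ∈ S.powerset, (-1 : ℝ) ^ #T • avg μi T

theorem comp_apply (S : Finset (Fin k)) (f : (∀ i, V i) → ℝ) :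
    comp μi S f = (-1 : ℝ) ^ #S • ∑ T ∈ S.powerset, (-1 : ℝ) ^ #T • avg μi T f := by
  simp [comp]

theorem sum_powerset_neg_one_pow_smul_eq_zero {ι M : Type*} [DecidableEq ι] [AddCommGroup M]
    [Module ℝ M] {S : Finset ι} {i : ι} (hi : i ∈ S) (φ : Finset ι → M)
    (hφ : ∀ T, φ (T.erase i) = φ T) :
    ∑ T ∈ S.powerset, (-1 : ℝ) ^ #T • φ T = 0 := by
  rw [← insert_erase hi, sum_powerset_insert (notMem_erase i S), ← sum_add_distrib]
  refine sum_eq_zero fun T hT => ?_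
  have hiT : i ∉ T := fun h => notMem_erase i S (mem_powerset.1 hT h)
  rw [card_insert_of_notMem hiT, ← hφ (insert i T), erase_insert hiT, pow_succ]
  simp

theorem sum_powerset_neg_one_pow_indicator {ι : Type*} [DecidableEq ι] (S R : Finset ι) :
    ∑ T ∈ S.powerset, (-1 : ℝ) ^ #T * (if T ⊆ R then 1 else 0) =
      if Disjoint S R then 1 else 0 := by
  split_ifs with h
  · rw [sum_eq_single ∅]
    · simp
    · intro T hT hne
      rw [if_neg, mul_zero]
      intro hTR
      exact hne (disjoint_self.1 (h.mono (mem_powerset.1 hT) hTR))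
    · simp
  · obtain ⟨i, hS, hR⟩ := not_disjoint_iff.1 h
    refine sum_powerset_neg_one_pow_smul_eq_zero hS (fun T => if T ⊆ R then (1 : ℝ) else 0) ?_
    intro T
    have : T.erase i ⊆ R ↔ T ⊆ R := by
      rw [← subset_insert_iff, insert_eq_of_mem hR]
    simp [this]

variable {μi}



theorem sum_prodMeasure (hsum : ∀ i, ∑ x, μi i x = 1) : ∑ x, prodMeasure μi x = 1 := by
  simp only [prodMeasure]
  rw [← Fintype.prod_sum]
  simp [hsum]

/-- Replacing the coordinates outside `S` by independent copies preserves the product measure. -/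
theorem sum_sum_piecewise (hsum : ∀ i, ∑ x, μi i x = 1) (S : Finset (Fin k))
    (g : (∀ i, V i) → ℝ) :
    ∑ z, ∑ w, prodMeasure μi z * (prodMeasure μi w * g (S.piecewise z w)) =
      ∑ z, prodMeasure μi z * g z := by
  have key : ∑ p : (∀ i, V i) × (∀ i, V i),
        prodMeasure μi p.1 * (prodMeasure μi p.2 * g (S.piecewise p.1 p.2)) =
      ∑ p : (∀ i, V i) × (∀ i, V i), prodMeasure μi p.1 * (prodMeasure μi p.2 * g p.1) := by
    have hinv : Function.Involutive (fun p : (∀ i, V i) × (∀ i, V i) =>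
        (S.piecewise p.1 p.2, S.piecewise p.2 p.1)) := by
      rintro ⟨z, w⟩
      ext i <;> by_cases hi : i ∈ S <;> simp [hi]
    refine Fintype.sum_equiv hinv.toPerm _ _ ?_
    rintro ⟨z, w⟩
    simp only [Function.Involutive.coe_toPerm, ← mul_assoc, prodMeasure, ← prod_mul_distrib]
    congr 1
    refine prod_congr rfl fun i _ => ?_
    by_cases hi : i ∈ S <;> simp [hi, mul_comm]
  rw [Fintype.sum_prod_type, Fintype.sum_prod_type] at key
  rw [key]
  refine sum_congr rfl fun z _ => ?_
  dsimp only
  rw [← mul_sum, ← sum_mul, sum_prodMeasure hsum, one_mul]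

theorem expect_avg (hsum : ∀ i, ∑ x, μi i x = 1) (S : Finset (Fin k)) (f : (∀ i, V i) → ℝ) :
    expect (prodMeasure μi) (avg μi S f) = expect (prodMeasure μi) f := by
  simp only [expect, avg_apply, mul_sum]
  exact sum_sum_piecewise hsum S f

theorem avg_avg (hsum : ∀ i, ∑ x, μi i x = 1) (S T : Finset (Fin k)) (f : (∀ i, V i) → ℝ) :
    avg μi S (avg μi T f) = avg μi (S ∩ T) f := by
  funext x
  simp only [avg_apply, mul_sum]
  rw [← sum_sum_piecewise hsum T]
  refine sum_congr rfl fun z _ => sum_congr rfl fun w _ => ?_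
  congr 3
  ext i
  by_cases hS : i ∈ S <;> by_cases hT : i ∈ T <;> simp [hS, hT]

theorem avg_univ (hsum : ∀ i, ∑ x, μi i x = 1) (f : (∀ i, V i) → ℝ) : avg μi univ f = f := by
  funext x
  simp [avg_apply, ← sum_mul, sum_prodMeasure hsum]

theorem avg_mul_of_avg_eq {S : Finset (Fin k)} {g : (∀ i, V i) → ℝ} (hg : avg μi S g = g)
    (h : (∀ i, V i) → ℝ) : avg μi S (g * h) = g * avg μi S h := by
  have hjunta : ∀ x z, g (S.piecewise x z) = g x := by
    intro x z
    conv_lhs => rw [← hg]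
    conv_rhs => rw [← hg]
    simp only [avg_apply]
    refine sum_congr rfl fun w _ => ?_
    congr 2
    ext i
    by_cases hi : i ∈ S <;> simp [hi]
  funext x
  simp only [avg_apply, Pi.mul_apply, mul_sum, hjunta]
  exact sum_congr rfl fun z _ => by ring

theorem expect_avg_mul_avg (hsum : ∀ i, ∑ x, μi i x = 1) {S T : Finset (Fin k)}
    (hST : Disjoint S T) (f g : (∀ i, V i) → ℝ) :
    expect (prodMeasure μi) (avg μi S f * avg μi T g) =
      expect (prodMeasure μi) f * expect (prodMeasure μi) g := by
  have hconst : avg μi ∅ g = fun _ => expect (prodMeasure μi) g := by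
    funext x
    simp [avg_apply, expect]
  rw [← expect_avg hsum S, avg_mul_of_avg_eq (by rw [avg_avg hsum, inter_self]),
    avg_avg hsum, disjoint_iff_inter_eq_empty.1 hST, hconst, ← expect_avg hsum S f]
  simp only [expect, Pi.mul_apply, sum_mul, mul_assoc]

theorem comp_avg_erase_of_mem (hsum : ∀ i, ∑ x, μi i x = 1) {S : Finset (Fin k)} {i : Fin k}
    (hi : i ∈ S) (f : (∀ i, V i) → ℝ) : comp μi S (avg μi (univ.erase i) f) = 0 := by
  rw [comp_apply, sum_powerset_neg_one_pow_smul_eq_zero hi, smul_zero]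
  intro T
  simp only [avg_avg hsum]
  congr 2
  ext j
  simp

theorem comp_avg_erase_of_notMem (hsum : ∀ i, ∑ x, μi i x = 1) {S : Finset (Fin k)} {i : Fin k}
    (hi : i ∉ S) (f : (∀ i, V i) → ℝ) : comp μi S (avg μi (univ.erase i) f) = comp μi S f := by
  simp only [comp_apply, avg_avg hsum]
  congr 1
  refine sum_congr rfl fun T hT => ?_
  congr 3
  ext j
  have := @(mem_powerset.1 hT)
  simp only [mem_inter, mem_erase, mem_univ, and_true, and_iff_left_iff_imp]
  rintro hj rfl
  exact hi (this hj)

theorem sum_comp (hsum : ∀ i, ∑ x, μi i x = 1) (f : (∀ i, V i) → ℝ) :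
    ∑ S, comp μi S f = f := by
  have h1 : ∀ S : Finset (Fin k), comp μi S f =
      ∑ T, ((-1 : ℝ) ^ #S * if T ⊆ S then 1 else 0) • ((-1 : ℝ) ^ #T • avg μi T f) := by
    intro S
    rw [comp_apply, smul_sum, ← filter_subset_univ, sum_filter]
    refine sum_congr rfl fun T _ => ?_
    split_ifs <;> simp
  simp only [h1]
  rw [sum_comm, sum_eq_single univ]
  · rw [sum_eq_single univ]
    · simp [avg_univ hsum, smul_smul, ← mul_pow]
    · intro S _ hS
      simp [univ_subset_iff, hS]
    · simp
  · intro T _ hT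
    obtain ⟨i, hi⟩ : ∃ i, i ∉ T := by
      by_contra! h
      exact hT (eq_univ_iff_forall.2 h)
    rw [← sum_smul, ← powerset_univ]
    have := sum_powerset_neg_one_pow_smul_eq_zero (mem_univ i)
      (fun S : Finset (Fin k) => if T ⊆ S then (1 : ℝ) else 0) (fun S => by
        simp [subset_erase, hi])
    simp only [smul_eq_mul] at this
    rw [this, zero_smul]
  · simp

variable (μi) in
/-- `F` behaves like a family of Efron–Stein components. -/
structure IsEfronStein (F : Finset (Fin k) → (∀ i, V i) → ℝ) : Prop where
  avg_of_subset : ∀ {S T : Finset (Fin k)}, S ⊆ T → avg μi T (F S) = F S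
  avg_erase_of_mem : ∀ {S : Finset (Fin k)} {i : Fin k}, i ∈ S → avg μi (univ.erase i) (F S) = 0

theorem isEfronStein_comp (hsum : ∀ i, ∑ x, μi i x = 1) (f : (∀ i, V i) → ℝ) :
    IsEfronStein μi (fun S => comp μi S f) where
  avg_of_subset {S T} hST := by
    simp only [comp_apply, map_smul, map_sum, avg_avg hsum]
    congr 1
    refine sum_congr rfl fun R hR => ?_
    rw [inter_eq_right.2 ((mem_powerset.1 hR).trans hST)]
  avg_erase_of_mem {S i} hi := by
    simp only [comp_apply, map_smul, map_sum, avg_avg hsum]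
    rw [sum_powerset_neg_one_pow_smul_eq_zero hi (fun T => avg μi (univ.erase i ∩ T) f),
      smul_zero]
    intro T
    congr 2
    ext j
    simp

theorem IsEfronStein.avg_erase_of_notMem {F : Finset (Fin k) → (∀ i, V i) → ℝ}
    (hF : IsEfronStein μi F) {S : Finset (Fin k)} {i : Fin k} (hi : i ∉ S) :
    avg μi (univ.erase i) (F S) = F S :=
  hF.avg_of_subset (subset_erase.2 ⟨subset_univ S, hi⟩)

theorem IsEfronStein.avg_erase_mul {F : Finset (Fin k) → (∀ i, V i) → ℝ}
    (hF : IsEfronStein μi F) {S T : Finset (Fin k)} {i : Fin k} (hi : i ∈ symmDiff S T) :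
    avg μi (univ.erase i) (F S * F T) = 0 := by
  rcases mem_symmDiff.1 hi with ⟨h1, h2⟩ | ⟨h1, h2⟩
  · rw [mul_comm, avg_mul_of_avg_eq (hF.avg_erase_of_notMem h2), hF.avg_erase_of_mem h1, mul_zero]
  · rw [avg_mul_of_avg_eq (hF.avg_erase_of_notMem h2), hF.avg_erase_of_mem h1, mul_zero]

theorem IsEfronStein.expect_mul_eq_zero (hsum : ∀ i, ∑ x, μi i x = 1)
    {F : Finset (Fin k) → (∀ i, V i) → ℝ} (hF : IsEfronStein μi F) {S T : Finset (Fin k)}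
    (hST : S ≠ T) : expect (prodMeasure μi) (F S * F T) = 0 := by
  obtain ⟨i, hi⟩ : (symmDiff S T).Nonempty := symmDiff_nonempty.2 hST
  rw [← expect_avg hsum (univ.erase i), hF.avg_erase_mul hi]
  simp [expect]

theorem IsEfronStein.normSq_sum (hsum : ∀ i, ∑ x, μi i x = 1)
    {F : Finset (Fin k) → (∀ i, V i) → ℝ} (hF : IsEfronStein μi F) :
    normSq (prodMeasure μi) (∑ S, F S) = ∑ S, normSq (prodMeasure μi) (F S) := by
  have h1 : normSq (prodMeasure μi) (∑ S, F S) =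
      ∑ S, ∑ T, expect (prodMeasure μi) (F S * F T) := by
    simp only [normSq, expect, Finset.sum_apply, sq, Pi.mul_apply, sum_mul_sum]
    simp only [mul_sum]
    rw [sum_comm]
    exact sum_congr rfl fun S _ => sum_comm
  rw [h1]
  refine sum_congr rfl fun S _ => ?_
  rw [sum_eq_single S (fun T _ hT => hF.expect_mul_eq_zero hsum hT.symm) (by simp)]
  simp [expect, normSq, sq]

theorem sum_normSq_comp (hsum : ∀ i, ∑ x, μi i x = 1) (f : (∀ i, V i) → ℝ) :
    ∑ S, normSq (prodMeasure μi) (comp μi S f) = normSq (prodMeasure μi) f := by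
  rw [← (isEfronStein_comp hsum f).normSq_sum hsum, sum_comp hsum]

theorem comp_eq_zero_of_mem (hsum : ∀ i, ∑ x, μi i x = 1) {S : Finset (Fin k)} {i : Fin k}
    (hi : i ∈ S) {g : (∀ i, V i) → ℝ} (hg : avg μi (univ.erase i) g = g) : comp μi S g = 0 := by
  rw [← hg, comp_avg_erase_of_mem hsum hi]

theorem comp_eq_zero_of_notMem (hsum : ∀ i, ∑ x, μi i x = 1) {S : Finset (Fin k)} {i : Fin k}
    (hi : i ∉ S) {g : (∀ i, V i) → ℝ} (hg : avg μi (univ.erase i) g = 0) : comp μi S g = 0 := by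
  rw [← comp_avg_erase_of_notMem hsum hi, hg, map_zero]

theorem IsEfronStein.comp_mul_eq_zero (hsum : ∀ i, ∑ x, μi i x = 1)
    {F : Finset (Fin k) → (∀ i, V i) → ℝ} (hF : IsEfronStein μi F) {S T R : Finset (Fin k)}
    (hS : ¬ (symmDiff T R ⊆ S ∧ S ⊆ T ∪ R)) : comp μi S (F T * F R) = 0 := by
  by_cases h : symmDiff T R ⊆ S
  · obtain ⟨i, hi, hiTR⟩ := not_subset.1 (fun h' => hS ⟨h, h'⟩)
    rw [mem_union, not_or] at hiTR
    refine comp_eq_zero_of_mem hsum hi ?_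
    rw [avg_mul_of_avg_eq (hF.avg_erase_of_notMem hiTR.1), hF.avg_erase_of_notMem hiTR.2]
  · obtain ⟨i, hi, hiS⟩ := not_subset.1 h
    exact comp_eq_zero_of_notMem hsum hiS (hF.avg_erase_mul hi)

theorem IsEfronStein.comp_symmDiff_mul (hsum : ∀ i, ∑ x, μi i x = 1)
    {F : Finset (Fin k) → (∀ i, V i) → ℝ} (hF : IsEfronStein μi F) (T R : Finset (Fin k)) :
    comp μi (symmDiff T R) (F T * F R) = avg μi (symmDiff T R) (F T * F R) := by
  rw [comp_apply, sum_eq_single (symmDiff T R)]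
  · simp [smul_smul, ← mul_pow]
  · intro Q hQ hne
    obtain ⟨i, hi, hiQ⟩ := not_subset.1 (fun h => hne ((mem_powerset.1 hQ).antisymm h))
    have : avg μi Q (F T * F R) = avg μi Q (avg μi (univ.erase i) (F T * F R)) := by
      rw [avg_avg hsum, inter_eq_left.2 (subset_erase.2 ⟨subset_univ Q, hiQ⟩)]
    rw [this, hF.avg_erase_mul hi, map_zero, smul_zero]
  · simp

/-- The sum of the components above `S`. -/
def upperSum (F : Finset (Fin k) → (∀ i, V i) → ℝ) (S : Finset (Fin k)) : (∀ i, V i) → ℝ :=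
  ∑ T, (if S ⊆ T then 1 else 0 : ℝ) • F T

omit [∀ i, Fintype (V i)] in
theorem upperSum_mul_upperSum (F : Finset (Fin k) → (∀ i, V i) → ℝ) (Q : Finset (Fin k)) :
    upperSum F Q * upperSum F Q =
      ∑ T, ∑ R, (if Q ⊆ T ∩ R then 1 else 0 : ℝ) • (F T * F R) := by
  rw [upperSum, sum_mul_sum]
  refine sum_congr rfl fun T _ => sum_congr rfl fun R _ => ?_
  rw [smul_mul_smul_comm]
  congr 1
  by_cases h1 : Q ⊆ T <;> by_cases h2 : Q ⊆ R <;> simp [h1, h2, subset_inter_iff]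

theorem IsEfronStein.sum_comp_upperSum_sq (hsum : ∀ i, ∑ x, μi i x = 1)
    {F : Finset (Fin k) → (∀ i, V i) → ℝ} (hF : IsEfronStein μi F) (S : Finset (Fin k)) :
    ∑ Q ∈ S.powerset, (-1 : ℝ) ^ #Q • comp μi S (upperSum F Q * upperSum F Q) =
      ∑ T, avg μi S (F T * F (symmDiff T S)) := by
  have h1 : ∑ Q ∈ S.powerset, (-1 : ℝ) ^ #Q • comp μi S (upperSum F Q * upperSum F Q) =
      ∑ T, ∑ R, (if Disjoint S (T ∩ R) then 1 else 0 : ℝ) • comp μi S (F T * F R) := by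
    simp only [upperSum_mul_upperSum, map_sum, map_smul, smul_sum, smul_smul,
      ← sum_powerset_neg_one_pow_indicator, sum_smul]
    rw [sum_comm]
    exact sum_congr rfl fun T _ => sum_comm
  rw [h1]
  refine sum_congr rfl fun T _ => ?_
  rw [sum_eq_single (symmDiff T S)]
  · have hd : Disjoint S (T ∩ symmDiff T S) := by
      rw [disjoint_left]
      intro i hi hi'
      simp only [mem_inter, mem_symmDiff] at hi'
      tauto
    have := hF.comp_symmDiff_mul hsum T (symmDiff T S)
    rw [symmDiff_symmDiff_cancel_left] at this
    rw [if_pos hd, one_smul, this]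
  · intro R _ hR
    split_ifs with hd
    · rw [one_smul]
      refine hF.comp_mul_eq_zero hsum ?_
      rintro ⟨h2, h3⟩
      refine hR ?_
      have : S = symmDiff T R := by
        refine Subset.antisymm (fun i hi => ?_) h2
        have h4 := h3 hi
        have h5 := disjoint_left.1 hd hi
        simp only [mem_union, mem_inter, mem_symmDiff] at *
        tauto
      rw [this, symmDiff_symmDiff_cancel_left]
    · rw [zero_smul]
  · simp

omit [∀ i, Fintype (V i)] in
theorem prodMeasure_nonneg (hnn : ∀ i x, 0 ≤ μi i x) (x : ∀ i, V i) : 0 ≤ prodMeasure μi x :=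
  prod_nonneg fun i _ => hnn i (x i)

theorem normSq_nonneg (hnn : ∀ i x, 0 ≤ μi i x) (f : (∀ i, V i) → ℝ) :
    0 ≤ normSq (prodMeasure μi) f :=
  sum_nonneg fun x _ => mul_nonneg (prodMeasure_nonneg hnn x) (sq_nonneg _)

theorem avg_mul_self_nonneg (hnn : ∀ i x, 0 ≤ μi i x) (S : Finset (Fin k))
    (f : (∀ i, V i) → ℝ) (x : ∀ i, V i) : 0 ≤ avg μi S (f * f) x :=
  sum_nonneg fun z _ => mul_nonneg (prodMeasure_nonneg hnn z) (mul_self_nonneg _)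

theorem avg_mul_sq_le (hnn : ∀ i x, 0 ≤ μi i x) (S : Finset (Fin k))
    (f g : (∀ i, V i) → ℝ) (x : ∀ i, V i) :
    avg μi S (f * g) x ^ 2 ≤ avg μi S (f * f) x * avg μi S (g * g) x := by
  simp only [avg_apply, Pi.mul_apply]
  refine sum_sq_le_sum_mul_sum_of_sq_le_mul _
    (fun z _ => mul_nonneg (prodMeasure_nonneg hnn z) (mul_self_nonneg _))
    (fun z _ => mul_nonneg (prodMeasure_nonneg hnn z) (mul_self_nonneg _)) fun z _ => ?_
  exact le_of_eq (by ring)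

/-- Cauchy–Schwarz, first over the traces on `S` and then over the sets with a given trace. -/
theorem sum_avg_mul_sq_le (hnn : ∀ i x, 0 ≤ μi i x) (F : Finset (Fin k) → (∀ i, V i) → ℝ)
    (S : Finset (Fin k)) (x : ∀ i, V i) :
    (∑ T, avg μi S (F T * F (symmDiff T S)) x) ^ 2 ≤
      2 ^ #S * ∑ T, ∑ R, (if S ⊆ symmDiff T R then 1 else 0 : ℝ) *
        (avg μi S (F T * F T) x * avg μi S (F R * F R) x) := by
  have hfib : ∀ φ : Finset (Fin k) → ℝ,
      ∑ T, φ T = ∑ A ∈ S.powerset, ∑ T with T ∩ S = A, φ T := fun φ =>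
    (sum_fiberwise_of_maps_to (fun T _ => mem_powerset.2 inter_subset_right) φ).symm
  rw [hfib]
  refine (sq_sum_le_card_mul_sum_sq).trans ?_
  rw [card_powerset, Nat.cast_pow, Nat.cast_ofNat]
  refine mul_le_mul_of_nonneg_left ?_ (by positivity)
  rw [hfib]
  refine sum_le_sum fun A _ => ?_
  refine (sum_sq_le_sum_mul_sum_of_sq_le_mul _
    (fun T _ => avg_mul_self_nonneg hnn S (F T) x)
    (fun T _ => avg_mul_self_nonneg hnn S (F (symmDiff T S)) x)
    (fun T _ => avg_mul_sq_le hnn S _ _ x)).trans (le_of_eq ?_)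
  rw [sum_mul]
  refine sum_congr rfl fun T hT => ?_
  have hT : T ∩ S = A := (mem_filter.1 hT).2
  simp only [mul_left_comm _ (avg μi S (F T * F T) x), ← mul_sum]
  congr 1
  rw [sum_filter]
  have hinv : Function.Involutive (fun R => symmDiff R S) := symmDiff_left_involutive S
  refine Fintype.sum_equiv hinv.toPerm _ _ fun R => ?_
  have hiff : S ⊆ symmDiff T (symmDiff R S) ↔ R ∩ S = A := by
    rw [← hT]
    simp only [subset_iff, Finset.ext_iff, mem_symmDiff, mem_inter]
    refine forall_congr' fun i => ?_
    tauto
  simp only [Function.Involutive.coe_toPerm, hiff]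
  split_ifs <;> simp

theorem IsEfronStein.expect_avg_sq_mul_avg_sq (hsum : ∀ i, ∑ x, μi i x = 1)
    {F : Finset (Fin k) → (∀ i, V i) → ℝ} (hF : IsEfronStein μi F) {S T R : Finset (Fin k)}
    (hS : S ⊆ symmDiff T R) :
    expect (prodMeasure μi) (avg μi S (F T * F T) * avg μi S (F R * F R)) =
      normSq (prodMeasure μi) (F T) * normSq (prodMeasure μi) (F R) := by
  have h1 : ∀ T, avg μi S (F T * F T) = avg μi (S ∩ T) (F T * F T) := by
    intro T
    have hT := hF.avg_of_subset (Subset.refl T)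
    rw [← avg_avg hsum, avg_mul_of_avg_eq hT, hT]
  have h2 : Disjoint (S ∩ T) (S ∩ R) := by
    rw [disjoint_left]
    intro i hi hi'
    have := mem_symmDiff.1 (hS (mem_inter.1 hi).1)
    simp only [mem_inter] at hi hi'
    tauto
  rw [h1 T, h1 R, expect_avg_mul_avg hsum h2]
  simp only [expect, normSq, Pi.mul_apply, sq]

theorem IsEfronStein.normSq_sum_avg_le (hnn : ∀ i x, 0 ≤ μi i x) (hsum : ∀ i, ∑ x, μi i x = 1)
    {F : Finset (Fin k) → (∀ i, V i) → ℝ} (hF : IsEfronStein μi F) (S : Finset (Fin k)) :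
    normSq (prodMeasure μi) (∑ T, avg μi S (F T * F (symmDiff T S))) ≤
      ∑ T, ∑ R, (if S ⊆ symmDiff T R then 2 ^ #S else 0 : ℝ) *
        (normSq (prodMeasure μi) (F T) * normSq (prodMeasure μi) (F R)) := by
  calc normSq (prodMeasure μi) (∑ T, avg μi S (F T * F (symmDiff T S)))
      ≤ ∑ x, prodMeasure μi x * (2 ^ #S * ∑ T, ∑ R, (if S ⊆ symmDiff T R then 1 else 0 : ℝ) *
          (avg μi S (F T * F T) x * avg μi S (F R * F R) x)) := by
        refine sum_le_sum fun x _ => mul_le_mul_of_nonneg_left ?_ (prodMeasure_nonneg hnn x)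
        rw [Finset.sum_apply]
        exact sum_avg_mul_sq_le hnn F S x
    _ = ∑ T, ∑ R, (if S ⊆ symmDiff T R then 2 ^ #S else 0 : ℝ) *
          expect (prodMeasure μi) (avg μi S (F T * F T) * avg μi S (F R * F R)) := by
        simp only [expect, mul_sum, Pi.mul_apply]
        rw [sum_comm]
        refine sum_congr rfl fun T _ => ?_
        rw [sum_comm]
        refine sum_congr rfl fun R _ => sum_congr rfl fun x _ => ?_
        split_ifs <;> ring
    _ = _ := by
        refine sum_congr rfl fun T _ => sum_congr rfl fun R _ => ?_
        split_ifs with h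
        · rw [hF.expect_avg_sq_mul_avg_sq hsum h]
        · simp

theorem IsEfronStein.sum_normSq_sum_avg_le (hnn : ∀ i x, 0 ≤ μi i x)
    (hsum : ∀ i, ∑ x, μi i x = 1) {F : Finset (Fin k) → (∀ i, V i) → ℝ}
    (hF : IsEfronStein μi F) {d : ℕ} (hd : ∀ S, d < #S → F S = 0) :
    ∑ S, normSq (prodMeasure μi) (∑ T, avg μi S (F T * F (symmDiff T S))) ≤
      9 ^ d * normSq (prodMeasure μi) (∑ S, F S) ^ 2 := by
  have hpow : ∀ Q : Finset (Fin k), ∑ S, (if S ⊆ Q then 2 ^ #S else 0 : ℝ) = 3 ^ #Q := by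
    intro Q
    have := sum_pow_mul_eq_add_pow (2 : ℝ) 1 Q
    norm_num at this
    rw [← sum_filter, filter_subset_univ, this]
  refine (sum_le_sum fun S _ => hF.normSq_sum_avg_le hnn hsum S).trans ?_
  rw [hF.normSq_sum hsum, sq, sum_mul_sum, sum_comm, mul_sum]
  refine sum_le_sum fun T _ => ?_
  rw [sum_comm, mul_sum]
  refine sum_le_sum fun R _ => ?_
  rw [← sum_mul, hpow]
  by_cases hT : d < #T
  · simp [hd T hT, normSq]
  by_cases hR : d < #R
  · simp [hd R hR, normSq]
  refine mul_le_mul_of_nonneg_right ?_ (mul_nonneg (normSq_nonneg hnn _) (normSq_nonneg hnn _))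
  have hcard : #(symmDiff T R) ≤ 2 * d := by
    have h1 : #(symmDiff T R) ≤ #(T ∪ R) := card_le_card fun i hi => by
      rw [mem_symmDiff] at hi
      rw [mem_union]
      tauto
    have := card_union_le T R
    omega
  calc (3 : ℝ) ^ #(symmDiff T R) ≤ 3 ^ (2 * d) := pow_le_pow_right₀ (by norm_num) hcard
    _ = 9 ^ d := by rw [pow_mul]; norm_num

theorem sum_powerset_erase_inv_pow_le_one {ι : Type*} [DecidableEq ι] {S : Finset ι} {d : ℕ}
    (hS : #S ≤ 2 * d) : ∑ Q ∈ S.powerset.erase ∅, ((4 * (d : ℝ))⁻¹) ^ #Q ≤ 1 := by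
  have h1 : ∑ Q ∈ S.powerset, ((4 * (d : ℝ))⁻¹) ^ #Q = ((4 * (d : ℝ))⁻¹ + 1) ^ #S := by
    simpa using sum_pow_mul_eq_add_pow ((4 * (d : ℝ))⁻¹) 1 S
  have h2 := add_sum_erase S.powerset (fun Q => ((4 * (d : ℝ))⁻¹) ^ #Q) (empty_mem_powerset S)
  have h3 : ((4 * (d : ℝ))⁻¹ + 1) ^ #S ≤ 2 := by
    have h0 : 0 ≤ (4 * (d : ℝ))⁻¹ := by positivity
    have hsq : (Real.exp (1 / 2)) ^ 2 ≤ 2 ^ 2 := by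
      rw [← Real.exp_nat_mul]
      norm_num
      linarith [Real.exp_one_lt_three]
    calc ((4 * (d : ℝ))⁻¹ + 1) ^ #S ≤ ((4 * (d : ℝ))⁻¹ + 1) ^ (2 * d) :=
          pow_le_pow_right₀ (by linarith) hS
      _ ≤ Real.exp ((4 * (d : ℝ))⁻¹) ^ (2 * d) :=
          pow_le_pow_left₀ (by positivity) (Real.add_one_le_exp _) _
      _ = Real.exp ((2 * d : ℕ) * (4 * (d : ℝ))⁻¹) := by rw [← Real.exp_nat_mul]
      _ ≤ Real.exp (1 / 2) := by
          rw [Real.exp_le_exp]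
          rcases Nat.eq_zero_or_pos d with rfl | hd
          · norm_num
          · have : (d : ℝ) ≠ 0 := by positivity
            push_cast
            field_simp
            norm_num
      _ ≤ 2 := by
          exact (pow_le_pow_iff_left₀ (Real.exp_nonneg _) (by norm_num) (by norm_num)).1 hsq
  simp only [card_empty, pow_zero] at h2
  linarith

theorem sub_signed_sum_sq_le {ι : Type*} [DecidableEq ι] {S : Finset ι} {d : ℕ}
    (hS : #S ≤ 2 * d) (m : ℝ) (a : Finset ι → ℝ) :
    (m - ∑ Q ∈ S.powerset.erase ∅, (-1 : ℝ) ^ #Q * a Q) ^ 2 ≤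
      2 * m ^ 2 + 2 * ∑ Q ∈ S.powerset.erase ∅, (4 * (d : ℝ)) ^ #Q * a Q ^ 2 := by
  have h1 : (∑ Q ∈ S.powerset.erase ∅, (-1 : ℝ) ^ #Q * a Q) ^ 2 ≤
      (∑ Q ∈ S.powerset.erase ∅, ((4 * (d : ℝ))⁻¹) ^ #Q) *
        ∑ Q ∈ S.powerset.erase ∅, (4 * (d : ℝ)) ^ #Q * a Q ^ 2 := by
    refine sum_sq_le_sum_mul_sum_of_sq_le_mul _ (fun Q _ => by positivity)
      (fun Q _ => by positivity) fun Q hQ => ?_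
    obtain ⟨hne, hQS⟩ := mem_erase.1 hQ
    have hcard := card_le_card (mem_powerset.1 hQS)
    have hpos := card_pos.2 (nonempty_iff_ne_empty.2 hne)
    have hd : 4 * (d : ℝ) ≠ 0 := by
      have : 0 < d := by omega
      positivity
    rw [← mul_assoc, ← mul_pow, inv_mul_cancel₀ hd, one_pow, one_mul, mul_pow, ← pow_mul,
      mul_comm #Q 2, pow_mul]
    simp
  have h2 : (0 : ℝ) ≤ ∑ Q ∈ S.powerset.erase ∅, (4 * (d : ℝ)) ^ #Q * a Q ^ 2 :=
    sum_nonneg fun Q _ => by positivity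
  have h3 := mul_le_of_le_one_left h2 (sum_powerset_erase_inv_pow_le_one hS)
  nlinarith [sq_nonneg (m + ∑ Q ∈ S.powerset.erase ∅, (-1 : ℝ) ^ #Q * a Q)]

omit [∀ i, Fintype (V i)] in
theorem upperSum_empty (F : Finset (Fin k) → (∀ i, V i) → ℝ) : upperSum F ∅ = ∑ S, F S := by
  simp [upperSum]

theorem IsEfronStein.normSq_comp_le (hnn : ∀ i x, 0 ≤ μi i x)
    (hsum : ∀ i, ∑ x, μi i x = 1) {F : Finset (Fin k) → (∀ i, V i) → ℝ}
    (hF : IsEfronStein μi F) {d : ℕ} (hd : ∀ S, d < #S → F S = 0) (S : Finset (Fin k)) :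
    normSq (prodMeasure μi) (comp μi S (upperSum F ∅ * upperSum F ∅)) ≤
      2 * normSq (prodMeasure μi) (∑ T, avg μi S (F T * F (symmDiff T S))) +
        2 * ∑ Q ∈ S.powerset.erase ∅, (4 * (d : ℝ)) ^ #Q *
          normSq (prodMeasure μi) (comp μi S (upperSum F Q * upperSum F Q)) := by
  by_cases hS : #S ≤ 2 * d
  · have h1 : comp μi S (upperSum F ∅ * upperSum F ∅) =
        (∑ T, avg μi S (F T * F (symmDiff T S))) - ∑ Q ∈ S.powerset.erase ∅,
          (-1 : ℝ) ^ #Q • comp μi S (upperSum F Q * upperSum F Q) := by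
      rw [← hF.sum_comp_upperSum_sq hsum, ← add_sum_erase _ _ (empty_mem_powerset S)]
      simp
    have h2 : ∀ x, prodMeasure μi x * (comp μi S (upperSum F ∅ * upperSum F ∅) x) ^ 2 ≤
        prodMeasure μi x * (2 * (∑ T, avg μi S (F T * F (symmDiff T S))) x ^ 2 +
          2 * ∑ Q ∈ S.powerset.erase ∅, (4 * (d : ℝ)) ^ #Q *
            comp μi S (upperSum F Q * upperSum F Q) x ^ 2) := by
      intro x
      refine mul_le_mul_of_nonneg_left ?_ (prodMeasure_nonneg hnn x)
      rw [h1, Pi.sub_apply, Finset.sum_apply (a := x) (s := S.powerset.erase ∅)]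
      exact sub_signed_sum_sq_le hS _ _
    refine (sum_le_sum fun x _ => h2 x).trans (le_of_eq ?_)
    simp only [normSq, mul_add, sum_add_distrib, mul_sum]
    congr 1
    · exact sum_congr rfl fun x _ => by ring
    · rw [sum_comm]
      exact sum_congr rfl fun Q _ => sum_congr rfl fun x _ => by ring
  · have h0 : comp μi S (upperSum F ∅ * upperSum F ∅) = 0 := by
      rw [upperSum_empty, sum_mul_sum, map_sum]
      refine sum_eq_zero fun T _ => ?_
      rw [map_sum]
      refine sum_eq_zero fun R _ => ?_
      by_cases hT : d < #T
      · simp [hd T hT]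
      by_cases hR : d < #R
      · simp [hd R hR]
      refine hF.comp_mul_eq_zero hsum fun h => hS ?_
      have := card_le_card h.2
      have := card_union_le T R
      omega
    rw [h0]
    have h1 := normSq_nonneg hnn (∑ T, avg μi S (F T * F (symmDiff T S)))
    have h2 : 0 ≤ ∑ Q ∈ S.powerset.erase ∅, (4 * (d : ℝ)) ^ #Q *
        normSq (prodMeasure μi) (comp μi S (upperSum F Q * upperSum F Q)) :=
      sum_nonneg fun Q _ => mul_nonneg (by positivity) (normSq_nonneg hnn _)
    have h3 : normSq (prodMeasure μi) (0 : (∀ i, V i) → ℝ) = 0 := by simp [normSq]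
    rw [h3]
    linarith

theorem norm4p4_eq_normSq_mul_self (μ f : (∀ i, V i) → ℝ) : norm4p4 μ f = normSq μ (f * f) := by
  simp only [norm4p4, normSq, Pi.mul_apply]
  exact sum_congr rfl fun x _ => by ring

theorem IsEfronStein.norm4p4_sum_le (hnn : ∀ i x, 0 ≤ μi i x)
    (hsum : ∀ i, ∑ x, μi i x = 1) {F : Finset (Fin k) → (∀ i, V i) → ℝ}
    (hF : IsEfronStein μi F) {d : ℕ} (hd : ∀ S, d < #S → F S = 0) :
    (1 / 2 : ℝ) * norm4p4 (prodMeasure μi) (∑ S, F S) ≤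
      9 ^ d * normSq (prodMeasure μi) (∑ S, F S) ^ 2 +
        ∑ Q with Q ≠ ∅, (4 * (d : ℝ)) ^ #Q * norm4p4 (prodMeasure μi) (upperSum F Q) := by
  have h1 := sum_le_sum fun S (_ : S ∈ univ) => hF.normSq_comp_le hnn hsum hd S
  rw [sum_normSq_comp hsum, sum_add_distrib, ← mul_sum, ← mul_sum, upperSum_empty,
    ← norm4p4_eq_normSq_mul_self] at h1
  have h2 := hF.sum_normSq_sum_avg_le hnn hsum hd
  have h3 : ∑ S, ∑ Q ∈ S.powerset.erase ∅, (4 * (d : ℝ)) ^ #Q *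
        normSq (prodMeasure μi) (comp μi S (upperSum F Q * upperSum F Q)) ≤
      ∑ Q with Q ≠ ∅, (4 * (d : ℝ)) ^ #Q * norm4p4 (prodMeasure μi) (upperSum F Q) := by
    have h4 : ∀ Q, norm4p4 (prodMeasure μi) (upperSum F Q) =
        ∑ S, normSq (prodMeasure μi) (comp μi S (upperSum F Q * upperSum F Q)) := fun Q => by
      rw [norm4p4_eq_normSq_mul_self, sum_normSq_comp hsum]
    simp only [h4, mul_sum]
    rw [sum_comm (s := univ.filter (· ≠ ∅))]
    refine sum_le_sum fun S _ => sum_le_sum_of_subset_of_nonneg (fun Q hQ => ?_) fun Q _ _ =>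
      mul_nonneg (by positivity) (normSq_nonneg hnn _)
    exact mem_filter.2 ⟨mem_univ Q, (mem_erase.1 hQ).1⟩
  linarith

end Averaging

section Support

variable {μi : ∀ i, V i → ℝ}

theorem Aop_eq_avg (hnn : ∀ i x, 0 ≤ μi i x) (hsum : ∀ i, ∑ x, μi i x = 1)
    (S : Finset (Fin k)) (f : (∀ i, V i) → ℝ) {x : ∀ i, V i} (hx : prodMeasure μi x ≠ 0) :
    Aop (prodMeasure μi) S f x = avg μi S f x := by
  have hpos : 0 < marg (prodMeasure μi) S x := by
    have h1 : (if ∀ i ∈ S, x i = x i then prodMeasure μi x else 0) ≤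
        marg (prodMeasure μi) S x :=
      single_le_sum (f := fun z => if ∀ i ∈ S, z i = x i then prodMeasure μi z else 0)
        (fun z _ => by split_ifs <;> simp [prodMeasure_nonneg hnn]) (mem_univ x)
    simp only [implies_true, if_true] at h1
    exact ((prodMeasure_nonneg hnn x).lt_of_ne' hx).trans_le h1
  have key : marg (prodMeasure μi) S x * avg μi S f x =
      ∑ z, prodMeasure μi z * (if ∀ i ∈ S, z i = x i then f z else 0) := by
    rw [← sum_sum_piecewise hsum S, marg, sum_mul]
    refine sum_congr rfl fun w _ => ?_
    rw [avg_apply, mul_sum]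
    refine sum_congr rfl fun z _ => ?_
    have hiff : (∀ i ∈ S, S.piecewise w z i = x i) ↔ ∀ i ∈ S, w i = x i :=
      forall₂_congr fun i hi => by rw [piecewise_eq_of_mem _ _ _ hi]
    simp only [hiff]
    split_ifs with h
    · have : S.piecewise w z = S.piecewise x z := by
        ext i
        by_cases hi : i ∈ S <;> simp [hi, h]
      rw [this]
    · simp
  rw [← mul_right_inj' hpos.ne', key, Aop, mul_sum]
  refine sum_congr rfl fun z _ => ?_
  rw [cond]
  split_ifs
  · field_simp
  · simp

theorem ES_eq_comp (hnn : ∀ i x, 0 ≤ μi i x) (hsum : ∀ i, ∑ x, μi i x = 1)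
    (S : Finset (Fin k)) (f : (∀ i, V i) → ℝ) {x : ∀ i, V i} (hx : prodMeasure μi x ≠ 0) :
    ES (prodMeasure μi) S f x = comp μi S f x := by
  rw [ES, comp_apply, Pi.smul_apply, Finset.sum_apply, smul_sum]
  refine sum_congr rfl fun T hT => ?_
  have hcard := card_le_card (mem_powerset.1 hT)
  rw [Aop_eq_avg hnn hsum T f hx, Pi.smul_apply, smul_smul, smul_eq_mul, ← pow_add]
  congr 1
  rw [← Nat.sub_add_cancel hcard, Nat.add_sub_cancel, add_assoc, pow_add, ← two_mul]
  simp

end Support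

theorem statement6 (k : ℕ) (hk : 1 ≤ k)
    (V : Fin k → Type) [∀ i, Fintype (V i)] [∀ i, DecidableEq (V i)]
    (μi : ∀ i, V i → ℝ) (hnn : ∀ i x, 0 ≤ μi i x) (hsum : ∀ i, ∑ x, μi i x = 1)
    (d : ℕ) (f : (∀ i, V i) → ℝ) (hdeg : DegLe (prodMeasure μi) d f) :
    (1 / 2 : ℝ) * norm4p4 (prodMeasure μi) f ≤
      9 ^ d * (normSq (prodMeasure μi) f) ^ 2 +
        ∑ T ∈ univ.powerset.filter (fun T : Finset (Fin k) => T ≠ ∅),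
          (4 * (d : ℝ)) ^ T.card * norm4p4 (prodMeasure μi) (Lap (prodMeasure μi) T f) := by
  set F : Finset (Fin k) → (∀ i, V i) → ℝ := fun S => if #S ≤ d then comp μi S f else 0 with hFdef
  have hF : IsEfronStein μi F := by
    have hc := isEfronStein_comp hsum f
    constructor
    · intro S T hST
      by_cases h : #S ≤ d
      · simpa [hFdef, h] using hc.avg_of_subset hST
      · simp [hFdef, h]
    · intro S i hi
      by_cases h : #S ≤ d
      · simpa [hFdef, h] using hc.avg_erase_of_mem hi
      · simp [hFdef, h]
  have hFd : ∀ S, d < #S → F S = 0 := fun S hS => if_neg hS.not_ge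
  have hcomp : ∀ x, prodMeasure μi x ≠ 0 → ∀ S, comp μi S f x = F S x := by
    intro x hx S
    by_cases h : #S ≤ d
    · simp [hFdef, h]
    · rw [← ES_eq_comp hnn hsum S f hx, hdeg S (not_le.1 h) x, hFd S (not_le.1 h), Pi.zero_apply]
  have hf : ∀ x, prodMeasure μi x ≠ 0 → f x = (∑ S, F S) x := by
    intro x hx
    conv_lhs => rw [← sum_comp hsum f]
    simp only [Finset.sum_apply, hcomp x hx]
  have hLap : ∀ T x, prodMeasure μi x ≠ 0 →
      Lap (prodMeasure μi) T f x = upperSum F T x := by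
    intro T x hx
    simp only [Lap, upperSum, powerset_univ, sum_filter, Finset.sum_apply, Pi.smul_apply,
      ES_eq_comp hnn hsum _ f hx, hcomp x hx, smul_eq_mul, ite_mul, one_mul, zero_mul]
  have hcongr : ∀ (n : ℕ) {g h : (∀ i, V i) → ℝ}, (∀ x, prodMeasure μi x ≠ 0 → g x = h x) →
      ∑ x, prodMeasure μi x * g x ^ n = ∑ x, prodMeasure μi x * h x ^ n := by
    intro n g h hgh
    refine sum_congr rfl fun x _ => ?_
    by_cases hx : prodMeasure μi x = 0
    · simp [hx]
    · rw [hgh x hx]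
  have h4 : ∀ {g h : (∀ i, V i) → ℝ}, (∀ x, prodMeasure μi x ≠ 0 → g x = h x) →
      norm4p4 (prodMeasure μi) g = norm4p4 (prodMeasure μi) h := hcongr 4
  have h2 : normSq (prodMeasure μi) f = normSq (prodMeasure μi) (∑ S, F S) := hcongr 2 hf
  rw [h4 hf, h2, powerset_univ]
  simp only [fun T => h4 (hLap T)]
  exact hF.norm4p4_sum_le hnn hsum hFd

end GLL
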